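/- Let A be a unital C*-algebra, let γ ∈ A be invertible, and let q₀, q₊ ∈ A be self-adjoint elements with γq₀ = q₀γ, γq₊ = −q₊γ, and such that (q₀ + q₊)² commutes with γ. Then q₊ commutes with √((q₀ + q₊)²), the square root of the non-negative element (q₀ + q₊)² taken via the continuous functional calculus. -/

import Mathlib

/-- If `g` is a unit commuting with `a` and with `(a + b) ^ 2` and anticommuting with `b`,
then `a` and `b` anticommute. -/
theorem mul_add_mul_eq_zero_of_commute_add_sq {R : Type*} [Ring R] [Module ℚ R] {g a b : R}
    (hg : IsUnit g) (ha : g * a = a * g) (hb : g * b = -(b * g))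
    (hsq : (a + b) ^ 2 * g = g * (a + b) ^ 2) : a * b + b * a = 0 := by
  have hab : g * (a * b) = -(a * b * g) := by
    rw [← mul_assoc, ha, mul_assoc, hb, mul_neg, mul_assoc]
  have hba : g * (b * a) = -(b * a * g) := by
    rw [← mul_assoc, hb, neg_mul, mul_assoc, ha, mul_assoc]
  have haa : g * (a * a) = a * a * g := by
    rw [← mul_assoc, ha, mul_assoc, ha, mul_assoc]
  have hbb : g * (b * b) = b * b * g := by
    rw [← mul_assoc, hb, neg_mul, mul_assoc, hb, mul_neg, neg_neg, mul_assoc]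
  have hexp : (a + b) ^ 2 = a * a + b * b + (a * b + b * a) := by noncomm_ring
  rw [hexp] at hsq
  simp only [mul_add, add_mul, hab, hba, haa, hbb] at hsq
  have hneg : (a * b + b * a) * g = -((a * b + b * a) * g) := by
    rw [add_mul, neg_add]
    exact add_left_cancel hsq
  have htwo : (2 : ℚ) • ((a * b + b * a) * g) = 0 := by
    rw [two_smul]
    exact eq_neg_iff_add_eq_zero.mp hneg
  exact hg.mul_left_eq_zero.mp ((smul_eq_zero_iff_right two_ne_zero).mp htwo)

/-- If `a` and `b` anticommute, then `b` commutes with `(a + b) ^ 2`. -/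
theorem commute_add_sq_of_mul_add_mul_eq_zero {R : Type*} [Ring R] {a b : R}
    (h : a * b + b * a = 0) : Commute b ((a + b) ^ 2) := by
  have hba : b * a = -(a * b) := (neg_eq_of_add_eq_zero_right h).symm
  have hexp : (a + b) ^ 2 = a * a + b * b + (a * b + b * a) := by noncomm_ring
  rw [hexp, h, add_zero]
  refine Commute.add_right ?_ (Commute.mul_right rfl rfl)
  change b * (a * a) = a * a * b
  rw [← mul_assoc, hba, neg_mul, mul_assoc, hba, mul_neg, neg_neg, mul_assoc]


/-- Operator-algebraic form of Lemma 2: in a unital C*-algebra, with `γ` invertible,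
`q₀, qPlus` self-adjoint, `q₀` commuting and `qPlus` anticommuting with `γ`, and
`(q₀ + qPlus)²` commuting with `γ`, the element `qPlus` commutes with `√((q₀ + qPlus)²)`
(square root via the continuous functional calculus). -/
theorem stmt_4 {A : Type*} [CStarAlgebra A] [PartialOrder A] [StarOrderedRing A] (γ q₀ qPlus : A) (hγ : IsUnit γ)
    (hq₀ : IsSelfAdjoint q₀) (hqPlus : IsSelfAdjoint qPlus)
    (h₀ : γ * q₀ = q₀ * γ) (hPlus : γ * qPlus = -(qPlus * γ))
    (hsq : (q₀ + qPlus) ^ 2 * γ = γ * (q₀ + qPlus) ^ 2) :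
    qPlus * CFC.sqrt ((q₀ + qPlus) ^ 2) = CFC.sqrt ((q₀ + qPlus) ^ 2) * qPlus := by
  have : Module ℚ A := Module.compHom A (algebraMap ℚ ℂ)
  have hcomm : Commute qPlus ((q₀ + qPlus) ^ 2) :=
    commute_add_sq_of_mul_add_mul_eq_zero
      (mul_add_mul_eq_zero_of_commute_add_sq hγ h₀ hPlus hsq)
  exact (hcomm.symm.cfcₙ_nnreal NNReal.sqrt).symm.eq
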